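/- Coupling time in the high service rate case (Theorem 6): assume μ > Σ_{i=1}^I λ_i. Then the backward coupling time of the detailed chain, τ = min{t ≥ 0 : |f̃(N, u_t u_{t−1}⋯u_1)| = 1} (where f̃(U, w) = {f̃(n, w) : n ∈ U} and the word applies u_t first), satisfies E[τ] ≤ Λ|C|/(μ − Σ_{i=1}^I λ_i). -/

import Mathlib

open MeasureTheory Finset ENNReal

namespace ATO

/-- Events: joint arrivals `d A` for subsets `A`, and joint-return services `s i j = r_j^i`. -/
inductive Ev (I : ℕ) where
  | d : Finset (Fin I) → Ev I
  | s : Fin I → ℕ → Ev I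

instance (I : ℕ) : MeasurableSpace (Ev I) := ⊤

/-- Valid events: arrivals for nonempty `A`, services `r_j^i` with `1 ≤ j ≤ C i`. -/
def ValidEv {I : ℕ} (C : Fin I → ℕ) : Ev I → Prop
  | .d A => A.Nonempty
  | .s i j => 1 ≤ j ∧ j ≤ C i

/-- The detailed state space `N`: coordinates indexed by the nonempty subsets `A`
(the `∅` coordinate is forced to `0`), with `∑_{A ∋ i} n_A ≤ C_i` for every `i`. -/
def Nspace {I : ℕ} (C : Fin I → ℕ) : Set (Finset (Fin I) → ℕ) :=
  {n | n ∅ = 0 ∧ ∀ i, (∑ A ∈ Finset.univ.filter (fun A => i ∈ A), n A) ≤ C i}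

/-- The projection `ψ : N → X`, `ψ(n)_i = ∑_{A ∋ i} n_A`. -/
def psi {I : ℕ} (n : Finset (Fin I) → ℕ) : Fin I → ℕ :=
  fun i => ∑ A ∈ Finset.univ.filter (fun A => i ∈ A), n A

/-- The projected state space `X = {0,…,C 1} × ⋯ × {0,…,C I}`. -/
def Xspace {I : ℕ} (C : Fin I → ℕ) : Set (Fin I → ℕ) := {x | ∀ i, x i ≤ C i}

/-- The enumeration `A_k^i` of the subsets of `{i,…,I}` containing `i` (0-based indices):
an element `t > i` belongs to `A_k^i` iff the binary digit of `k` in position `I - 1 - t`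
vanishes. -/
def Aset {I : ℕ} (i : Fin I) (k : ℕ) : Finset (Fin I) :=
  Finset.univ.filter (fun t => t = i ∨ (i < t ∧ Nat.testBit k (I - 1 - t.val) = false))

/-- Partial sums `∑_{ℓ=0}^{k-1} n_{A_ℓ^i}`. -/
def psum {I : ℕ} (i : Fin I) (n : Finset (Fin I) → ℕ) (k : ℕ) : ℕ :=
  ∑ l ∈ Finset.range k, n (Aset i l)

/-- The transition function `f̃` of the detailed chain: a demand `d A` adds `ε_{A^{(n)}}`
where `A^{(n)} = {i ∈ A : ψ(n)_i < C_i}` (no change if `A^{(n)} = ∅`); a service `r_j^i`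
removes `ε_{A_k^i}` for the minimal `k` with `∑_{ℓ=0}^{k} n_{A_ℓ^i} ≥ j`, if
`∑_{ℓ} n_{A_ℓ^i} ≥ j`, and otherwise does nothing. -/
noncomputable def ftil {I : ℕ} (C : Fin I → ℕ) (n : Finset (Fin I) → ℕ) :
    Ev I → (Finset (Fin I) → ℕ)
  | .d A => fun B =>
      n B + if B = A.filter (fun i => psi n i < C i) ∧ B.Nonempty then 1 else 0
  | .s i j => fun B =>
      n B - if j ≤ psum i n (2 ^ (I - 1 - i.val))
              ∧ B = Aset i (sInf {k | j ≤ psum i n (k + 1)}) then 1 else 0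

/-- The supremum chain `f̄` on `X` (componentwise supremum over all detailed states
projecting to `x`). -/
noncomputable def fbar {I : ℕ} (C : Fin I → ℕ) (x : Fin I → ℕ) (a : Ev I) : Fin I → ℕ :=
  fun p => sSup ((fun n => psi (ftil C n a) p) '' {n | n ∈ Nspace C ∧ psi n = x})

/-- The infimum chain `f_inf` on `X` (componentwise infimum over all detailed states
projecting to `x`). -/
noncomputable def finf {I : ℕ} (C : Fin I → ℕ) (x : Fin I → ℕ) (a : Ev I) : Fin I → ℕ :=
  fun p => sInf ((fun n => psi (ftil C n a) p) '' {n | n ∈ Nspace C ∧ psi n = x})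

/-- One step of the aggregated envelope chain `F([m,M],a)`. -/
noncomputable def Fenv {I : ℕ} (C : Fin I → ℕ) (m M : Fin I → ℕ) (a : Ev I) :
    (Fin I → ℕ) × (Fin I → ℕ) :=
  (fun p => sInf ((fun x => finf C x a p) '' Set.Icc m M),
   fun p => sSup ((fun x => fbar C x a p) '' Set.Icc m M))

/-- Iteration of the aggregated envelope chain along a word (head applied first). -/
noncomputable def FenvIter {I : ℕ} (C : Fin I → ℕ) :
    (Fin I → ℕ) → (Fin I → ℕ) → List (Ev I) → (Fin I → ℕ) × (Fin I → ℕ)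
  | m, M, [] => (m, M)
  | m, M, a :: w => FenvIter C (Fenv C m M a).1 (Fenv C m M a).2 w

/-- Iterated application of a transition function along a word (head applied first). -/
def iter {I : ℕ} {σ : Type*} (f : σ → Ev I → σ) : σ → List (Ev I) → σ
  | x, [] => x
  | x, a :: w => iter f (f x a) w

/-- The backward word `u_t u_{t-1} ⋯ u_1` (with `u_t` applied first). -/
def bword {I : ℕ} (ω : ℕ → Ev I) (t : ℕ) : List (Ev I) :=
  ((List.range t).reverse).map fun s => ω (s + 1)

/-- The forward word `u_1 u_2 ⋯ u_t` (with `u_1` applied first). -/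
def fword {I : ℕ} (ω : ℕ → Ev I) (t : ℕ) : List (Ev I) :=
  (List.range t).map fun s => ω (s + 1)

/-- The "hat" operation `x̂_i = max{x_i − (x_1 + ⋯ + x_{i-1}), 0}`. -/
def xhat {I : ℕ} (x : Fin I → ℕ) (i : Fin I) : ℕ :=
  x i - ∑ t ∈ Finset.univ.filter (fun t => t < i), x t

/-- The distribution `ν` on events: `ν (d A) = λ_A / Λ` and `ν (r_j^i) = μ / Λ`. -/
noncomputable def probJ {I : ℕ} (C : Fin I → ℕ) (lam : Finset (Fin I) → ℝ) (μv Λ : ℝ) :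
    Ev I → ℝ≥0∞
  | .d A => if A.Nonempty then ENNReal.ofReal (lam A / Λ) else 0
  | .s i j => if 1 ≤ j ∧ j ≤ C i then ENNReal.ofReal (μv / Λ) else 0

/-- A dominating transition function on `Xspace C`: arrivals increase every concerned coordinate
up to its capacity, and `s i j` only acts when all coordinates before `i` vanish and
coordinate `i` equals `j`. -/
def domStep {I : ℕ} (C : Fin I → ℕ) (x : Fin I → ℕ) : Ev I → (Fin I → ℕ)
  | .d A => fun i => if i ∈ A then min (x i + 1) (C i) else x i
  | .s i j =>
      if x i = j ∧ 0 < j ∧ ∀ t < i, x t = 0 then Function.update x i (x i - 1) else x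

/-- The dominating chain started from `x` avoids `0` all along the word. -/
def Survives {I : ℕ} (C : Fin I → ℕ) : (Fin I → ℕ) → List (Ev I) → Prop
  | x, [] => x ≠ 0
  | x, a :: w => x ≠ 0 ∧ Survives C (domStep C x a) w

/-- Expectation of a function of one event. -/
noncomputable def evExp {I : ℕ} (C : Fin I → ℕ) (lam : Finset (Fin I) → ℝ) (μv Λ : ℝ)
    (F : Ev I → ℝ) : ℝ :=
  (∑ A, lam A / Λ * F (.d A)) + ∑ i, ∑ j ∈ Finset.Icc 1 (C i), μv / Λ * F (.s i j)

/-- Probability that the dominating chain started from `x` avoids `0` up to time `t`. -/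
noncomputable def survProb {I : ℕ} (C : Fin I → ℕ) (lam : Finset (Fin I) → ℝ) (μv Λ : ℝ) :
    ℕ → (Fin I → ℕ) → ℝ
  | 0, x => if x = 0 then 0 else 1
  | t + 1, x => if x = 0 then 0 else
      evExp C lam μv Λ (fun a => survProb C lam μv Λ t (domStep C x a))

section Dynamics

variable {I : ℕ} {C : Fin I → ℕ}

lemma domStep_mem_Xspace {x : Fin I → ℕ} (hx : x ∈ Xspace C) (a : Ev I) :
    domStep C x a ∈ Xspace C := by
  intro p
  have hp := hx p
  cases a with
  | d A =>
    simp only [domStep]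
    split_ifs
    · exact min_le_right _ _
    · exact hp
  | s i j =>
    simp only [domStep]
    split_ifs
    · by_cases h : p = i
      · subst h
        simp only [Function.update_self]
        omega
      · rwa [Function.update_of_ne h]
    · exact hp

lemma exists_Aset_eq {i : Fin I} {A : Finset (Fin I)} (hi : i ∈ A) (hA : ∀ t ∈ A, i ≤ t) :
    ∃ k < 2 ^ (I - 1 - i.val), Aset i k = A := by
  refine ⟨Nat.ofBits (n := I - 1 - i.val)
    (fun b => decide (∀ t ∈ A, t.val ≠ I - 1 - b.val)), Nat.ofBits_lt_two_pow _, ?_⟩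
  ext t
  have hti := t.isLt
  simp only [Aset, Finset.mem_filter, Finset.mem_univ, true_and]
  constructor
  · rintro (rfl | ⟨hit, hbit⟩)
    · exact hi
    · have hit' : i.val < t.val := hit
      rw [Nat.testBit_ofBits_lt _ _ (by omega)] at hbit
      simp only [decide_eq_false_iff_not, not_forall, not_not] at hbit
      obtain ⟨u, hu, hut⟩ := hbit
      have : u = t := Fin.ext (by omega)
      exact this ▸ hu
  · intro ht
    rcases (hA t ht).eq_or_lt with h | h
    · exact Or.inl h.symm
    · have h' : i.val < t.val := h
      refine Or.inr ⟨h, ?_⟩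
      rw [Nat.testBit_ofBits_lt _ _ (by omega)]
      simp only [decide_eq_false_iff_not, not_forall, not_not]
      exact ⟨t, ht, by omega⟩

lemma self_mem_Aset (i : Fin I) (k : ℕ) : i ∈ Aset i k := by
  simp [Aset]

lemma le_psi {n : Finset (Fin I) → ℕ} {i : Fin I} {A : Finset (Fin I)} (hi : i ∈ A) :
    n A ≤ psi n i :=
  Finset.single_le_sum (f := n) (fun _ _ => Nat.zero_le _) (by simpa using hi)

lemma psi_le_psum {n : Finset (Fin I) → ℕ} {i : Fin I} (h0 : ∀ t < i, psi n t = 0) :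
    psi n i ≤ psum i n (2 ^ (I - 1 - i.val)) := by
  have key : ∀ A ∈ Finset.univ.filter (fun A : Finset (Fin I) => i ∈ A), n A ≤
      ∑ k ∈ (Finset.range (2 ^ (I - 1 - i.val))).filter (fun k => Aset i k = A),
        n (Aset i k) := by
    intro A hA
    have hiA : i ∈ A := by simpa using hA
    by_cases hlow : ∀ t ∈ A, i ≤ t
    · obtain ⟨k, hk, rfl⟩ := exists_Aset_eq hiA hlow
      exact Finset.single_le_sum (f := fun k => n (Aset i k)) (fun _ _ => Nat.zero_le _)
        (by simpa using hk)
    · push Not at hlow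
      obtain ⟨t, ht, hti⟩ := hlow
      have := le_psi (n := n) ht
      rw [h0 t hti] at this
      omega
  refine (Finset.sum_le_sum key).trans (le_of_eq ?_)
  exact Finset.sum_fiberwise_of_maps_to (fun k _ => by simp [self_mem_Aset]) _

lemma ftil_s_le (n : Finset (Fin I) → ℕ) (i : Fin I) (j : ℕ) (B : Finset (Fin I)) :
    ftil C n (.s i j) B ≤ n B := by
  simp only [ftil]
  exact Nat.sub_le _ _

lemma psi_ftil_s_lt {n : Finset (Fin I) → ℕ} {i : Fin I} {j : ℕ} (hj : 0 < j)
    (h : j ≤ psum i n (2 ^ (I - 1 - i.val))) :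
    psi (ftil C n (.s i j)) i < psi n i := by
  have hne : {k | j ≤ psum i n (k + 1)}.Nonempty := by
    refine ⟨2 ^ (I - 1 - i.val) - 1, ?_⟩
    rw [Set.mem_ofPred_eq, Nat.sub_add_cancel Nat.one_le_two_pow]
    exact h
  set k := sInf {k | j ≤ psum i n (k + 1)} with hk
  have hmem : j ≤ psum i n (k + 1) := Nat.sInf_mem hne
  have hlt : psum i n k < j := by
    rcases Nat.eq_zero_or_pos k with h0 | hpos
    · rw [h0]
      simpa [psum] using hj
    · have hnot : k - 1 ∉ {k | j ≤ psum i n (k + 1)} := Nat.notMem_of_lt_sInf (by omega)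
      rw [Set.mem_ofPred_eq, Nat.sub_add_cancel hpos] at hnot
      omega
  have hpos : 0 < n (Aset i k) := by
    have : psum i n (k + 1) = psum i n k + n (Aset i k) := Finset.sum_range_succ _ _
    omega
  refine Finset.sum_lt_sum (fun B _ => ftil_s_le n i j B)
    ⟨Aset i k, by simp [self_mem_Aset], ?_⟩
  simp only [ftil, ← hk, h, and_self, if_true]
  omega

lemma psi_ftil_d (n : Finset (Fin I) → ℕ) (A : Finset (Fin I)) (p : Fin I) :
    psi (ftil C n (.d A)) p = psi n p + if p ∈ A ∧ psi n p < C p then 1 else 0 := by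
  simp only [ftil]
  conv_lhs => unfold psi
  rw [Finset.sum_add_distrib]
  congr 1
  by_cases h : p ∈ A ∧ psi n p < C p
  · rw [if_pos h, Finset.sum_eq_single (A.filter (fun i => psi n i < C i))]
    · rw [if_pos ⟨rfl, p, by simpa using h⟩]
    · intro B _ hB
      rw [if_neg (fun hc => hB hc.1)]
    · intro hc
      exact absurd (by simpa using h) hc
  · rw [if_neg h]
    refine Finset.sum_eq_zero fun B hB => if_neg ?_
    rintro ⟨rfl, _⟩
    exact h (Finset.mem_filter.mp (Finset.mem_filter.mp hB).2)

lemma psi_ftil_le_domStep {n : Finset (Fin I) → ℕ} {x : Fin I → ℕ} (hn : n ∈ Nspace C)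
    (hx : psi n ≤ x) (a : Ev I) : psi (ftil C n a) ≤ domStep C x a := by
  intro p
  have hp : psi n p ≤ x p := hx p
  have hC : psi n p ≤ C p := hn.2 p
  cases a with
  | d A =>
    rw [psi_ftil_d]
    simp only [domStep]
    by_cases hA : p ∈ A <;> by_cases hlt : psi n p < C p <;> simp [hA, hlt] <;> omega
  | s i j =>
    have hle : psi (ftil C n (.s i j)) p ≤ psi n p :=
      Finset.sum_le_sum fun B _ => ftil_s_le n i j B
    simp only [domStep]
    split_ifs with h
    · obtain ⟨hj, hj0, hlow⟩ := h
      by_cases hpi : p = i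
      · subst hpi
        rw [Function.update_self]
        by_cases hlt : psi n p = x p
        · have h0 : ∀ t < p, psi n t = 0 := fun t ht =>
            Nat.eq_zero_of_le_zero ((hx t).trans (hlow t ht).le)
          have := psi_ftil_s_lt (C := C) hj0
            (show j ≤ _ by rw [← hj, ← hlt]; exact psi_le_psum h0)
          omega
        · omega
      · rw [Function.update_of_ne hpi]
        omega
    · omega

lemma ftil_mem_Nspace {n : Finset (Fin I) → ℕ} (hn : n ∈ Nspace C) (a : Ev I) :
    ftil C n a ∈ Nspace C := by
  refine ⟨?_, fun i => ?_⟩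
  · have h0 := hn.1
    cases a <;> simp [ftil, h0]
  · exact (psi_ftil_le_domStep hn (x := C) (fun i => hn.2 i) a i).trans
      (domStep_mem_Xspace (fun i => le_rfl) a i)

lemma eq_zero_of_psi_le_zero {n : Finset (Fin I) → ℕ} (hn : n ∈ Nspace C) (h : psi n ≤ 0) :
    n = 0 := by
  funext A
  rcases A.eq_empty_or_nonempty with rfl | ⟨i, hi⟩
  · exact hn.1
  · exact Nat.eq_zero_of_le_zero ((le_psi hi).trans (h i))

lemma iter_eq_of_not_survives (w : List (Ev I)) :
    ∀ (x : Fin I → ℕ) (n n' : Finset (Fin I) → ℕ), ¬ Survives C x w → n ∈ Nspace C →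
      n' ∈ Nspace C → psi n ≤ x → psi n' ≤ x → iter (ftil C) n w = iter (ftil C) n' w := by
  induction w with
  | nil =>
    intro x n n' hs hn hn' h h'
    have hx : x = 0 := by simpa [Survives] using hs
    subst hx
    rw [eq_zero_of_psi_le_zero hn h, eq_zero_of_psi_le_zero hn' h']
  | cons a w ih =>
    intro x n n' hs hn hn' h h'
    by_cases hx : x = 0
    · subst hx
      rw [eq_zero_of_psi_le_zero hn h, eq_zero_of_psi_le_zero hn' h']
    · have hs' : ¬ Survives C (domStep C x a) w := fun hc => hs ⟨hx, hc⟩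
      exact ih _ _ _ hs' (ftil_mem_Nspace hn a) (ftil_mem_Nspace hn' a)
        (psi_ftil_le_domStep hn h a) (psi_ftil_le_domStep hn' h' a)

lemma zero_mem_Nspace : (0 : Finset (Fin I) → ℕ) ∈ Nspace C := by
  simp [Nspace]

lemma image_eq_singleton_of_not_survives {w : List (Ev I)} (h : ¬ Survives C C w) :
    (fun n => iter (ftil C) n w) '' Nspace C = {iter (ftil C) 0 w} := by
  refine Set.Subset.antisymm ?_ ?_
  · rintro _ ⟨n, hn, rfl⟩
    exact iter_eq_of_not_survives w C n 0 h hn zero_mem_Nspace (fun i => hn.2 i)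
      (fun i => zero_mem_Nspace.2 i)
  · rintro _ rfl
    exact ⟨0, zero_mem_Nspace, rfl⟩

lemma bword_succ (ω : ℕ → Ev I) (t : ℕ) : bword ω (t + 1) = ω (t + 1) :: bword ω t := by
  simp [bword, List.range_succ]

end Dynamics

section Drift

variable {I : ℕ} {C : Fin I → ℕ} {lam : Finset (Fin I) → ℝ} {μv Λ : ℝ}

lemma evExp_mono (hlam : ∀ A, 0 ≤ lam A) (hμ : 0 ≤ μv) (hΛ : 0 ≤ Λ) {F G : Ev I → ℝ}
    (h : ∀ a, F a ≤ G a) : evExp C lam μv Λ F ≤ evExp C lam μv Λ G := by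
  unfold evExp
  gcongr with A _ i _ j _
  · exact div_nonneg (hlam A) hΛ
  · exact h _
  · exact h _

lemma evExp_nonneg (hlam : ∀ A, 0 ≤ lam A) (hμ : 0 ≤ μv) (hΛ : 0 ≤ Λ) {F : Ev I → ℝ}
    (h : ∀ a, 0 ≤ F a) : 0 ≤ evExp C lam μv Λ F := by
  simpa [evExp] using evExp_mono (C := C) hlam hμ hΛ h

lemma evExp_sum (s : Finset ℕ) (F : ℕ → Ev I → ℝ) :
    evExp C lam μv Λ (fun a => ∑ k ∈ s, F k a) = ∑ k ∈ s, evExp C lam μv Λ (F k) := by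
  simp only [evExp, Finset.mul_sum, Finset.sum_add_distrib]
  congr 1
  · exact Finset.sum_comm
  · rw [Finset.sum_comm (s := s)]
    exact Finset.sum_congr rfl fun i _ => Finset.sum_comm

lemma evExp_const_mul (c : ℝ) (F : Ev I → ℝ) :
    evExp C lam μv Λ (fun a => c * F a) = c * evExp C lam μv Λ F := by
  simp only [evExp, mul_add, Finset.mul_sum]
  congr 1
  · exact Finset.sum_congr rfl fun _ _ => by ring
  · exact Finset.sum_congr rfl fun _ _ => Finset.sum_congr rfl fun _ _ => by ring

lemma survProb_nonneg (hlam : ∀ A, 0 ≤ lam A) (hμ : 0 ≤ μv) (hΛ : 0 ≤ Λ) (t : ℕ) :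
    ∀ x : Fin I → ℕ, 0 ≤ survProb C lam μv Λ t x := by
  induction t with
  | zero => intro x; simp only [survProb]; split_ifs <;> norm_num
  | succ t ih =>
    intro x
    simp only [survProb]
    split_ifs
    · exact le_rfl
    · exact evExp_nonneg hlam hμ hΛ fun a => ih _

lemma sum_domStep_d_le (x : Fin I → ℕ) (A : Finset (Fin I)) :
    ∑ p, (domStep C x (.d A) p : ℝ) ≤ ∑ p, (x p : ℝ) + A.card := by
  have : (A.card : ℝ) = ∑ p, if p ∈ A then (1 : ℝ) else 0 := by simp
  rw [this, ← Finset.sum_add_distrib]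
  refine Finset.sum_le_sum fun p _ => ?_
  simp only [domStep]
  split_ifs
  · exact_mod_cast min_le_left _ _
  · simp

lemma sum_domStep_s (x : Fin I → ℕ) (i : Fin I) (j : ℕ) :
    ∑ p, (domStep C x (.s i j) p : ℝ) =
      ∑ p, (x p : ℝ) - if x i = j ∧ 0 < j ∧ ∀ t < i, x t = 0 then 1 else 0 := by
  simp only [domStep]
  split_ifs with h
  · obtain ⟨hj, hj0, -⟩ := h
    rw [← Finset.add_sum_erase _ _ (Finset.mem_univ i),
      ← Finset.add_sum_erase _ (fun p => (x p : ℝ)) (Finset.mem_univ i), Function.update_self,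
      Nat.cast_sub (by omega)]
    rw [Finset.sum_congr rfl (g := fun p => (x p : ℝ))]
    · push_cast; ring
    · intro p hp
      rw [Function.update_of_ne (Finset.ne_of_mem_erase hp)]
  · simp

lemma exists_first_ne_zero {x : Fin I → ℕ} (hx : x ≠ 0) :
    ∃ i, x i ≠ 0 ∧ ∀ t < i, x t = 0 := by
  obtain ⟨i, hi⟩ := Function.ne_iff.mp hx
  obtain ⟨m, hm, hmin⟩ := WellFounded.has_min (wellFounded_lt (α := Fin I))
    {i | x i ≠ 0} ⟨i, hi⟩
  exact ⟨m, hm, fun t ht => by_contra fun hc => hmin t hc ht⟩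

lemma evExp_sum_domStep_le (hlam : ∀ A, 0 ≤ lam A) (hμ : 0 ≤ μv) (hΛ0 : 0 < Λ)
    (hΛ : Λ = (∑ A, lam A) + μv * ∑ i, (C i : ℝ)) {x : Fin I → ℕ} (hx : x ≠ 0)
    (hxC : x ∈ Xspace C) :
    evExp C lam μv Λ (fun a => ∑ p, (domStep C x a p : ℝ)) ≤
      ∑ p, (x p : ℝ) - (μv - ∑ A, lam A * A.card) / Λ := by
  obtain ⟨i, hi, hlow⟩ := exists_first_ne_zero hx
  set X : ℝ := ∑ p, (x p : ℝ)
  set δ : Fin I → ℕ → ℝ := fun i j => if x i = j ∧ 0 < j ∧ ∀ t < i, x t = 0 then 1 else 0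
    with hδ
  have hδ0 : ∀ i j, 0 ≤ δ i j := fun i j => by simp only [hδ]; split_ifs <;> norm_num
  have hone : 1 ≤ ∑ i, ∑ j ∈ Finset.Icc 1 (C i), δ i j := by
    calc (1 : ℝ) = δ i (x i) := by
          exact (if_pos ⟨rfl, Nat.pos_of_ne_zero hi, hlow⟩).symm
      _ ≤ ∑ j ∈ Finset.Icc 1 (C i), δ i j :=
          Finset.single_le_sum (f := δ i) (fun j _ => hδ0 i j)
            (Finset.mem_Icc.mpr ⟨Nat.one_le_iff_ne_zero.mpr hi, hxC i⟩)
      _ ≤ _ := Finset.single_le_sum (f := fun i => ∑ j ∈ Finset.Icc 1 (C i), δ i j)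
            (fun i _ => Finset.sum_nonneg fun j _ => hδ0 i j) (Finset.mem_univ i)
  calc evExp C lam μv Λ (fun a => ∑ p, (domStep C x a p : ℝ))
      ≤ (∑ A, lam A / Λ * (X + A.card)) +
          ∑ i, ∑ j ∈ Finset.Icc 1 (C i), μv / Λ * (X - δ i j) := by
        unfold evExp
        gcongr with A _ i _ j _
        · exact div_nonneg (hlam A) hΛ0.le
        · exact sum_domStep_d_le x A
        · exact (sum_domStep_s x i j).le
    _ = X * (((∑ A, lam A) + μv * ∑ i, (C i : ℝ)) / Λ) + (∑ A, lam A * A.card) / Λ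
          - μv / Λ * ∑ i, ∑ j ∈ Finset.Icc 1 (C i), δ i j := by
        simp only [mul_add, mul_sub, Finset.sum_add_distrib, Finset.sum_sub_distrib,
          Finset.sum_const, Nat.card_Icc, nsmul_eq_mul, add_div, Finset.sum_div,
          Finset.mul_sum, Nat.add_sub_cancel]
        have h1 : ∑ A, lam A / Λ * X = ∑ A, X * (lam A / Λ) :=
          Finset.sum_congr rfl fun _ _ => by ring
        have h2 : ∑ A : Finset (Fin I), lam A / Λ * (A.card : ℝ)
            = ∑ A : Finset (Fin I), lam A * (A.card : ℝ) / Λ :=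
          Finset.sum_congr rfl fun _ _ => by ring
        have h3 : ∑ i, (C i : ℝ) * (μv / Λ * X) = ∑ i, X * (μv * (C i : ℝ) / Λ) :=
          Finset.sum_congr rfl fun _ _ => by ring
        rw [h1, h2, h3]
        ring
    _ ≤ X * 1 + (∑ A, lam A * A.card) / Λ - μv / Λ * 1 := by
        rw [← hΛ, div_self hΛ0.ne']
        gcongr
    _ = _ := by ring

lemma drift_mul_sum_survProb_le (hlam : ∀ A, 0 ≤ lam A) (hμ : 0 ≤ μv) (hΛ0 : 0 < Λ)
    (hΛ : Λ = (∑ A, lam A) + μv * ∑ i, (C i : ℝ)) (K : ℕ) :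
    ∀ x ∈ Xspace C, (μv - ∑ A, lam A * A.card) / Λ *
      ∑ t ∈ Finset.range K, survProb C lam μv Λ t x ≤ ∑ p, (x p : ℝ) := by
  induction K with
  | zero =>
    intro x _
    simpa using Finset.sum_nonneg fun p _ => Nat.cast_nonneg (α := ℝ) (x p)
  | succ K ih =>
    intro x hxC
    rw [Finset.sum_range_succ']
    by_cases hx : x = 0
    · simp [survProb, hx]
    · simp only [survProb, hx, if_false]
      rw [← evExp_sum, mul_add, ← evExp_const_mul]
      have h1 := evExp_mono (C := C) hlam hμ hΛ0.le (fun a => ih _ (domStep_mem_Xspace hxC a))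
      have h2 := evExp_sum_domStep_le hlam hμ hΛ0 hΛ hx hxC
      linarith

end Drift

section Measure

variable {I : ℕ} {C : Fin I → ℕ} {lam : Finset (Fin I) → ℝ} {μv Λ : ℝ}

/-- Events as a sum type. -/
def evEquiv (I : ℕ) : Finset (Fin I) ⊕ (Fin I × ℕ) ≃ Ev I where
  toFun := Sum.elim Ev.d fun q => Ev.s q.1 q.2
  invFun
    | .d A => .inl A
    | .s i j => .inr (i, j)
  left_inv := by rintro (A | ⟨i, j⟩) <;> rfl
  right_inv := by rintro (A | ⟨i, j⟩) <;> rfl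

instance countableEv : Countable (Ev I) := (evEquiv I).symm.injective.countable

lemma tsum_probJ_mul_ofReal (hlam : ∀ A, 0 ≤ lam A) (hlam0 : lam ∅ = 0) (hμ : 0 ≤ μv)
    (hΛ : 0 ≤ Λ) {F : Ev I → ℝ} (hF : ∀ a, 0 ≤ F a) :
    ∑' a, probJ C lam μv Λ a * ENNReal.ofReal (F a) =
      ENNReal.ofReal (evExp C lam μv Λ F) := by
  have hsplit : ∑' a, probJ C lam μv Λ a * ENNReal.ofReal (F a) =
      (∑ A, probJ C lam μv Λ (.d A) * ENNReal.ofReal (F (.d A))) +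
        ∑ i, ∑' j, probJ C lam μv Λ (.s i j) * ENNReal.ofReal (F (.s i j)) := by
    rw [← (evEquiv I).tsum_eq, ENNReal.summable.tsum_sum ENNReal.summable, tsum_fintype,
      ← tsum_fintype (L := .unconditional _) fun i =>
        ∑' j, probJ C lam μv Λ (.s i j) * ENNReal.ofReal (F (.s i j)), ← ENNReal.tsum_prod]
    rfl
  rw [hsplit]
  have hd : ∀ A, 0 ≤ lam A / Λ * F (.d A) := fun A =>
    mul_nonneg (div_nonneg (hlam A) hΛ) (hF _)
  have hs : ∀ i j, 0 ≤ μv / Λ * F (.s i j) := fun i j =>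
    mul_nonneg (div_nonneg hμ hΛ) (hF _)
  rw [evExp, ENNReal.ofReal_add (Finset.sum_nonneg fun A _ => hd A)
    (Finset.sum_nonneg fun i _ => Finset.sum_nonneg fun j _ => hs i j),
    ENNReal.ofReal_sum_of_nonneg fun A _ => hd A,
    ENNReal.ofReal_sum_of_nonneg fun i _ => Finset.sum_nonneg fun j _ => hs i j]
  congr 1
  · refine Finset.sum_congr rfl fun A _ => ?_
    rw [ENNReal.ofReal_mul (div_nonneg (hlam A) hΛ)]
    rcases A.eq_empty_or_nonempty with rfl | hA
    · simp [probJ, hlam0]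
    · simp [probJ, hA]
  · refine Finset.sum_congr rfl fun i _ => ?_
    rw [ENNReal.ofReal_sum_of_nonneg fun j _ => hs i j,
      tsum_eq_sum (s := Finset.Icc 1 (C i))]
    · refine Finset.sum_congr rfl fun j hj => ?_
      rw [ENNReal.ofReal_mul (div_nonneg hμ hΛ)]
      simp [probJ, Finset.mem_Icc.mp hj]
    · intro j hj
      rw [Finset.mem_Icc] at hj
      simp [probJ, hj]

lemma measure_survives_le (hlam : ∀ A, 0 ≤ lam A) (hlam0 : lam ∅ = 0) (hμ : 0 ≤ μv)
    (hΛ : 0 ≤ Λ) (P : Measure (ℕ → Ev I))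
    (hiid : ∀ (T : Finset ℕ) (u : ℕ → Ev I),
      P {ω | ∀ t ∈ T, ω t = u t} = ∏ t ∈ T, probJ C lam μv Λ (u t)) (t : ℕ) :
    ∀ (x : Fin I → ℕ) (T : Finset ℕ) (u : ℕ → Ev I), (∀ s ∈ T, t < s) →
      P {ω | Survives C x (bword ω t) ∧ ∀ s ∈ T, ω s = u s} ≤
        ENNReal.ofReal (survProb C lam μv Λ t x) * ∏ s ∈ T, probJ C lam μv Λ (u s) := by
  induction t with
  | zero =>
    intro x T u _
    by_cases hx : x = 0
    · simp [bword, Survives, hx]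
    · simp [bword, Survives, hx, survProb, hiid]
  | succ t ih =>
    intro x T u hT
    by_cases hx : x = 0
    · simp [bword_succ, Survives, hx]
    have hnot : t + 1 ∉ T := fun h => lt_irrefl _ (hT _ h)
    have hsub : {ω | Survives C x (bword ω (t + 1)) ∧ ∀ s ∈ T, ω s = u s} ⊆
        ⋃ a, {ω | Survives C (domStep C x a) (bword ω t) ∧
          ∀ s ∈ insert (t + 1) T, ω s = Function.update u (t + 1) a s} := by
      rintro ω ⟨hω, hu⟩
      rw [bword_succ] at hω
      refine Set.mem_iUnion.mpr ⟨ω (t + 1), hω.2, fun s hs => ?_⟩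
      rcases Finset.mem_insert.mp hs with rfl | hs
      · simp
      · rw [Function.update_of_ne (ne_of_mem_of_not_mem hs hnot)]
        exact hu s hs
    calc _ ≤ ∑' a, P {ω | Survives C (domStep C x a) (bword ω t) ∧
          ∀ s ∈ insert (t + 1) T, ω s = Function.update u (t + 1) a s} :=
          (measure_mono hsub).trans (measure_iUnion_le _)
      _ ≤ ∑' a, probJ C lam μv Λ a *
            ENNReal.ofReal (survProb C lam μv Λ t (domStep C x a)) *
            ∏ s ∈ T, probJ C lam μv Λ (u s) := by
          refine ENNReal.tsum_le_tsum fun a => ?_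
          refine (ih _ _ _ fun s hs => ?_).trans (le_of_eq ?_)
          · rcases Finset.mem_insert.mp hs with rfl | hs
            · omega
            · have := hT s hs
              omega
          · rw [Finset.prod_insert hnot, Function.update_self,
              Finset.prod_congr rfl (g := fun s => probJ C lam μv Λ (u s))]
            · ring
            · intro s hs
              rw [Function.update_of_ne (ne_of_mem_of_not_mem hs hnot)]
      _ = _ := by
          rw [ENNReal.tsum_mul_right, tsum_probJ_mul_ofReal hlam hlam0 hμ hΛ
            fun a => survProb_nonneg hlam hμ hΛ t _]
          simp [survProb, hx]

end Measure

/-- A first entrance time is at most the number of times spent outside, so its integral is at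
most the sum of the survival probabilities. -/
lemma lintegral_sInf_le_tsum_measure {Ω : Type*} [MeasurableSpace Ω] (P : Measure Ω)
    (good : Ω → ℕ → Prop) :
    ∫⁻ ω, sInf {r : ℝ≥0∞ | ∃ t : ℕ, r = t ∧ good ω t} ∂P ≤
      ∑' t, P {ω | ¬ good ω t} := by
  classical
  calc _ ≤ ∫⁻ ω, ∑' t, (toMeasurable P {ω | ¬ good ω t}).indicator 1 ω ∂P := by
        refine lintegral_mono fun ω => ?_
        have hbad : ∀ t, ¬ good ω t →
            (toMeasurable P {ω | ¬ good ω t}).indicator (1 : Ω → ℝ≥0∞) ω = 1 := fun t ht =>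
          Set.indicator_of_mem (subset_toMeasurable P _ ht) _
        by_cases h : ∃ t, good ω t
        · calc sInf {r : ℝ≥0∞ | ∃ t : ℕ, r = t ∧ good ω t}
              ≤ ((Nat.find h : ℕ) : ℝ≥0∞) := sInf_le ⟨_, rfl, Nat.find_spec h⟩
            _ = ∑ t ∈ Finset.range (Nat.find h),
                (toMeasurable P {ω | ¬ good ω t}).indicator (1 : Ω → ℝ≥0∞) ω := by
              rw [Finset.sum_congr rfl fun t ht =>
                hbad t (Nat.find_min h (Finset.mem_range.mp ht))]
              simp
            _ ≤ _ := ENNReal.sum_le_tsum _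
        · push Not at h
          simp [hbad _ (h _)]
    _ = ∑' t, P {ω | ¬ good ω t} := by
        rw [lintegral_tsum fun t =>
          (measurable_one.indicator (measurableSet_toMeasurable _ _)).aemeasurable]
        refine tsum_congr fun t => ?_
        rw [lintegral_indicator_one (measurableSet_toMeasurable _ _), measure_toMeasurable]

/-- Theorem 6: coupling time of the detailed chain in the high service rate case. -/
theorem stmt16 (I : ℕ) (hI : 1 ≤ I) (C : Fin I → ℕ) (hC : ∀ i, 1 ≤ C i)
    (lam : Finset (Fin I) → ℝ) (hlamnn : ∀ A, 0 ≤ lam A) (hlam0 : lam ∅ = 0)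
    (μv : ℝ) (hμv : 0 < μv)
    (Λ : ℝ) (hΛ : Λ = (∑ A : Finset (Fin I), lam A) + μv * ∑ i, (C i : ℝ))
    (lamI : Fin I → ℝ)
    (hlamI : ∀ i, lamI i = ∑ A ∈ Finset.univ.filter (fun A => i ∈ A), lam A)
    (P : Measure (ℕ → Ev I)) [IsProbabilityMeasure P]
    (hiid : ∀ (T : Finset ℕ) (u : ℕ → Ev I),
        P {ω | ∀ t ∈ T, ω t = u t} = ∏ t ∈ T, probJ C lam μv Λ (u t))
    (hs : ∑ i, lamI i < μv) :
    ∫⁻ ω, sInf {r : ℝ≥0∞ | ∃ t : ℕ, r = t ∧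
        ∃ c : Finset (Fin I) → ℕ, (fun n => iter (ftil C) n (bword ω t)) '' Nspace C = {c}} ∂P
      ≤ ENNReal.ofReal (Λ * (∑ i, (C i : ℝ)) / (μv - ∑ i, lamI i)) := by
  have hΛ0 : 0 < Λ := by
    have hpos : 0 < ∑ i, (C i : ℝ) :=
      Finset.sum_pos (fun i _ => Nat.cast_pos.mpr (hC i)) ⟨⟨0, hI⟩, Finset.mem_univ _⟩
    have hsum : 0 ≤ ∑ A, lam A := Finset.sum_nonneg fun A _ => hlamnn A
    rw [hΛ]
    positivity
  have hlamsum : ∑ i, lamI i = ∑ A, lam A * (A.card : ℝ) := by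
    simp only [hlamI, Finset.sum_filter]
    rw [Finset.sum_comm]
    refine Finset.sum_congr rfl fun A _ => ?_
    simp [mul_comm]
  refine (lintegral_sInf_le_tsum_measure P fun ω t => ∃ c : Finset (Fin I) → ℕ,
    (fun n => iter (ftil C) n (bword ω t)) '' Nspace C = {c}).trans
    (ENNReal.tsum_le_of_sum_range_le fun K => ?_)
  have hδ : 0 < (μv - ∑ i, lamI i) / Λ := div_pos (sub_pos.mpr hs) hΛ0
  calc _ ≤ ∑ t ∈ Finset.range K, ENNReal.ofReal (survProb C lam μv Λ t C) := by
        refine Finset.sum_le_sum fun t _ => ?_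
        have h := measure_survives_le hlamnn hlam0 hμv.le hΛ0.le P hiid t C ∅ (fun _ => .d ∅)
          (by simp)
        simp only [Finset.notMem_empty, false_implies, implies_true, and_true,
          Finset.prod_empty, mul_one] at h
        refine (measure_mono fun ω hω => ?_).trans h
        by_contra hc
        have hcoupled : ∃ c : Finset (Fin I) → ℕ,
            (fun n => iter (ftil C) n (bword ω t)) '' Nspace C = {c} :=
          ⟨_, image_eq_singleton_of_not_survives hc⟩
        exact hω hcoupled
    _ = ENNReal.ofReal (∑ t ∈ Finset.range K, survProb C lam μv Λ t C) :=
        (ENNReal.ofReal_sum_of_nonneg fun t _ =>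
          survProb_nonneg hlamnn hμv.le hΛ0.le t C).symm
    _ ≤ _ := by
        refine ENNReal.ofReal_le_ofReal ?_
        have h := drift_mul_sum_survProb_le hlamnn hμv.le hΛ0 hΛ K C fun i => le_rfl
        rw [← hlamsum] at h
        calc _ ≤ (∑ i, (C i : ℝ)) / ((μv - ∑ i, lamI i) / Λ) := by
              rwa [le_div_iff₀' hδ]
          _ = _ := by rw [div_div_eq_mul_div, mul_comm]

end ATO
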